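/- Let X be a finite metric graph with edge lengths 0 < ℓ₀ ≤ ℓ_e ≤ 1, G ⊆ G^max a vertex space with projection P, m ∈ ℝ, and M : G → G a self-adjoint linear operator. Let w ∈ ℂ with w ≠ ±m, set z := w² − m², and assume z ≠ (πk/ℓ_e)² for every edge e and every integer k ≥ 1. Let θ² = z and define Q(z) : G → G by (Q(z)F)(v) := P_v( {(θ/sin(θℓ_e))(cos(θℓ_e) F_e(v) − F_e(v_e))}_{e∈E_v} ). Then the map F ↦ ( β(z)F , (β(z)F)'/(w+m) ) is a linear bijection from ker( Q(z) − (w+m)M ) ⊆ G onto the eigenspace of the metric graph Dirac operator D_{(G,M)} for the eigenvalue w, i.e. onto the space of pairs f = (f₀, f₁) of edgewise continuously differentiable families satisfying m f₀ − f₁' = w f₀ and f₀' − m f₁ = w f₁ on every edge, f̲₀ ∈ G, and P(f̲₁°) = M f̲₀. -/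

import Mathlib

noncomputable section

open Complex Set MeasureTheory

variable {V E : Type*}

/-- Maximal vertex space: one copy of `ℂ` for each half-edge `(e, endpoint)`;
`(e, false)` corresponds to the initial vertex `∂₋e`, `(e, true)` to the terminal
vertex `∂₊e`. -/
abbrev Gmax (E : Type*) := E × Bool → ℂ

/-- The vertex of a half-edge, given the boundary map `bd` of the graph
(`bd false = ∂₋`, `bd true = ∂₊`). -/
def hvtx (bd : Bool → E → V) (h : E × Bool) : V := bd h.2 h.1

/-- The opposite half-edge on the same edge. -/
def hopp {E : Type*} (h : E × Bool) : E × Bool := (h.1, !h.2)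

/-- The standard Hermitian inner product on `Gmax E` (conjugate-linear in the
first argument). -/
def vinner [Fintype E] (F F' : Gmax E) : ℂ :=
  ∑ h : E × Bool, (starRingEnd ℂ) (F h) * F' h

/-- The squared norm on `Gmax E`. -/
def vnormSq [Fintype E] (F : Gmax E) : ℝ := ∑ h : E × Bool, ‖F h‖ ^ 2

/-- Restriction of `F` to the components sitting at the vertex `v`. -/
def restrAt [DecidableEq V] (bd : Bool → E → V) (v : V) (F : Gmax E) : Gmax E :=
  fun h => if bd h.2 h.1 = v then F h else 0

/-- Unoriented vertex evaluation of a family of edge functions. -/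
def utrace (ℓ : E → ℝ) (f : E → ℝ → ℂ) : Gmax E :=
  fun h => if h.2 then f h.1 (ℓ h.1) else f h.1 0

/-- Oriented vertex evaluation of a family of edge functions. -/
def otrace (ℓ : E → ℝ) (f : E → ℝ → ℂ) : Gmax E :=
  fun h => if h.2 then f h.1 (ℓ h.1) else -f h.1 0

/-- The generalised discrete Laplacian `Δ_G`, written with the (local) orthogonal
projection `P` onto the vertex space. -/
def discLap (ℓ : E → ℝ) (P : Gmax E →ₗ[ℂ] Gmax E) (F : Gmax E) : Gmax E :=
  P fun h => (ℓ h.1 : ℂ)⁻¹ * (F h - F (hopp h))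

/-- Krein's Q-function, for spectral parameter `z = θ ^ 2 ≠ 0`. -/
def QRaw (ℓ : E → ℝ) (P : Gmax E →ₗ[ℂ] Gmax E) (θ : ℂ) (F : Gmax E) : Gmax E :=
  P fun h => (θ / Complex.sin (θ * (ℓ h.1 : ℂ))) *
      (Complex.cos (θ * (ℓ h.1 : ℂ)) * F h - F (hopp h))

/-- Krein's Q-function, including the value `z = 0` where `Q(0) = Δ_G`. -/
def QFull (ℓ : E → ℝ) (P : Gmax E →ₗ[ℂ] Gmax E) (z θ : ℂ) (F : Gmax E) : Gmax E :=
  if z = 0 then discLap ℓ P F else QRaw ℓ P θ F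

/-- The solution operator (Krein Γ-field) `β(z)` for `z = θ ^ 2 ≠ 0`. -/
def betaFun (ℓ : E → ℝ) (θ : ℂ) (F : Gmax E) : E → ℝ → ℂ := fun e x =>
  F (e, false) * Complex.sin (θ * ((ℓ e : ℂ) - (x : ℂ))) / Complex.sin (θ * (ℓ e : ℂ))
    + F (e, true) * Complex.sin (θ * (x : ℂ)) / Complex.sin (θ * (ℓ e : ℂ))

/-- The solution operator `β(z)`, including the value `z = 0`. -/
def betaFull (ℓ : E → ℝ) (z θ : ℂ) (F : Gmax E) : E → ℝ → ℂ :=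
  if z = 0 then
    fun e x => F (e, false) * (1 - (x : ℂ) / (ℓ e : ℂ)) + F (e, true) * ((x : ℂ) / (ℓ e : ℂ))
  else betaFun ℓ θ F

/-- `sin₁ θ = sin θ / θ` with `sin₁ 0 = 1`. -/
def sin1 (θ : ℂ) : ℂ := if θ = 0 then 1 else Complex.sin θ / θ

/-- `f` belongs to the eigenspace of the metric-graph Laplacian `Δ_{(G,L)}` for the
eigenvalue `z`: each `f_e` is twice continuously differentiable on `[0, ℓ_e]`,
`-f_e'' = z f_e` on each edge, the unoriented vertex evaluation lies in `G`, and the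
vertex condition `P f'̲° = L f̲` holds. -/
def IsLapEigenfun (ℓ : E → ℝ) (G : Submodule ℂ (Gmax E)) (P : Gmax E →ₗ[ℂ] Gmax E)
    (L : G →ₗ[ℂ] G) (z : ℂ) (f : E → ℝ → ℂ) : Prop :=
  (∀ e, ContDiffOn ℝ 2 (f e) (Icc 0 (ℓ e))) ∧
  (∀ e, ∀ x ∈ Icc (0 : ℝ) (ℓ e),
      iteratedDerivWithin 2 (f e) (Icc 0 (ℓ e)) x = -(z * f e x)) ∧
  ∃ hf : utrace ℓ f ∈ G,
    P (otrace ℓ fun e x => derivWithin (f e) (Icc 0 (ℓ e)) x)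
      = ↑(L ⟨utrace ℓ f, hf⟩)

/-- `(f₀, f₁)` belongs to the eigenspace of the metric-graph Dirac operator
`D_{(G,M)}` for the eigenvalue `w`: edgewise `C¹`, the Dirac system
`m f₀ - f₁' = w f₀`, `f₀' - m f₁ = w f₁` holds on each edge, `f̲₀ ∈ G` and the
vertex condition `P f̲₁° = M f̲₀` holds. -/
def IsDiracEigenfun {E : Type*} (ℓ : E → ℝ) (G : Submodule ℂ (Gmax E))
    (P : Gmax E →ₗ[ℂ] Gmax E) (M : G →ₗ[ℂ] G) (m : ℝ) (w : ℂ)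
    (f₀ f₁ : E → ℝ → ℂ) : Prop :=
  (∀ e, ContDiffOn ℝ 1 (f₀ e) (Icc 0 (ℓ e))) ∧
  (∀ e, ContDiffOn ℝ 1 (f₁ e) (Icc 0 (ℓ e))) ∧
  (∀ e, ∀ x ∈ Icc (0 : ℝ) (ℓ e),
      (m : ℂ) * f₀ e x - derivWithin (f₁ e) (Icc 0 (ℓ e)) x = w * f₀ e x) ∧
  (∀ e, ∀ x ∈ Icc (0 : ℝ) (ℓ e),
      derivWithin (f₀ e) (Icc 0 (ℓ e)) x - (m : ℂ) * f₁ e x = w * f₁ e x) ∧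
  ∃ hf : utrace ℓ f₀ ∈ G,
    P (otrace ℓ f₁) = ↑(M ⟨utrace ℓ f₀, hf⟩)

theorem sin_mul_ne_zero_of_off_dirichlet {l : ℝ} (hl : 0 < l) {θ z : ℂ} (hθ : θ ^ 2 = z)
    (hz0 : z ≠ 0) (hz : ∀ k : ℕ, 1 ≤ k → z ≠ ((Real.pi * k / l : ℝ) : ℂ) ^ 2) :
    Complex.sin (θ * (l : ℂ)) ≠ 0 := by
  intro h
  obtain ⟨k, hk⟩ := Complex.sin_eq_zero_iff.mp h
  have hlc : (l : ℂ) ≠ 0 := by exact_mod_cast hl.ne'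
  have hθk : θ = k * Real.pi / l := by rw [eq_div_iff hlc, hk]
  have hk0 : k ≠ 0 := by
    rintro rfl
    apply hz0
    rw [← hθ, hθk]
    simp
  refine hz k.natAbs (Int.natAbs_pos.mpr hk0) ?_
  have hsq : ((k.natAbs : ℂ)) ^ 2 = (k : ℂ) ^ 2 := by
    rw [← Int.cast_natCast (R := ℂ)]
    exact_mod_cast congrArg (Int.cast : ℤ → ℂ) (Int.natAbs_sq k)
  rw [← hθ, hθk]
  push_cast
  rw [div_pow, div_pow, mul_pow, mul_pow, hsq, mul_comm]

/-- The edgewise derivative of `betaFun`. -/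
def betaDeriv (ℓ : E → ℝ) (θ : ℂ) (F : Gmax E) : E → ℝ → ℂ := fun e x =>
  θ / Complex.sin (θ * (ℓ e : ℂ)) *
    (F (e, true) * Complex.cos (θ * (x : ℂ))
      - F (e, false) * Complex.cos (θ * ((ℓ e : ℂ) - (x : ℂ))))

theorem hasDerivAt_mul_ofReal (θ : ℂ) (x : ℝ) :
    HasDerivAt (fun y : ℝ => θ * (y : ℂ)) θ x := by
  simpa using (hasDerivAt_id x).ofReal_comp.const_mul θ

theorem hasDerivAt_mul_sub_ofReal (θ a : ℂ) (x : ℝ) :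
    HasDerivAt (fun y : ℝ => θ * (a - (y : ℂ))) (-θ) x := by
  simpa using ((hasDerivAt_id x).ofReal_comp.const_sub a).const_mul θ

theorem hasDerivAt_sin_comp {u : ℝ → ℂ} {u' : ℂ} {x : ℝ} (hu : HasDerivAt u u' x) :
    HasDerivAt (fun y => Complex.sin (u y)) (Complex.cos (u x) * u') x :=
  (Complex.hasDerivAt_sin (u x)).comp x hu

theorem hasDerivAt_cos_comp {u : ℝ → ℂ} {u' : ℂ} {x : ℝ} (hu : HasDerivAt u u' x) :
    HasDerivAt (fun y => Complex.cos (u y)) (-Complex.sin (u x) * u') x :=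
  (Complex.hasDerivAt_cos (u x)).comp x hu

theorem hasDerivAt_betaFun (ℓ : E → ℝ) (θ : ℂ) (F : Gmax E) (e : E) (x : ℝ) :
    HasDerivAt (betaFun ℓ θ F e) (betaDeriv ℓ θ F e x) x := by
  have h := (((hasDerivAt_sin_comp (hasDerivAt_mul_sub_ofReal θ (ℓ e : ℂ) x)).const_mul
    (F (e, false))).div_const (Complex.sin (θ * (ℓ e : ℂ)))).add
    (((hasDerivAt_sin_comp (hasDerivAt_mul_ofReal θ x)).const_mul (F (e, true))).div_const
      (Complex.sin (θ * (ℓ e : ℂ))))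
  refine h.congr_deriv ?_
  simp only [betaDeriv]
  ring

theorem hasDerivAt_betaDeriv (ℓ : E → ℝ) (θ : ℂ) (F : Gmax E) (e : E) (x : ℝ) :
    HasDerivAt (betaDeriv ℓ θ F e) (-(θ ^ 2 * betaFun ℓ θ F e x)) x := by
  have h := (((hasDerivAt_cos_comp (hasDerivAt_mul_ofReal θ x)).const_mul (F (e, true))).sub
    ((hasDerivAt_cos_comp (hasDerivAt_mul_sub_ofReal θ (ℓ e : ℂ) x)).const_mul
      (F (e, false)))).const_mul (θ / Complex.sin (θ * (ℓ e : ℂ)))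
  refine h.congr_deriv ?_
  simp only [betaFun]
  ring

theorem deriv_betaFun (ℓ : E → ℝ) (θ : ℂ) (F : Gmax E) (e : E) :
    deriv (betaFun ℓ θ F e) = betaDeriv ℓ θ F e :=
  funext fun x => (hasDerivAt_betaFun ℓ θ F e x).deriv

theorem contDiff_one_of_hasDerivAt {f f' : ℝ → ℂ} (h : ∀ x, HasDerivAt f (f' x) x)
    (hf' : Continuous f') : ContDiff ℝ 1 f := by
  rw [contDiff_one_iff_deriv, show deriv f = f' from funext fun x => (h x).deriv]
  exact ⟨fun x => (h x).differentiableAt, hf'⟩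

theorem continuous_betaFun (ℓ : E → ℝ) (θ : ℂ) (F : Gmax E) (e : E) :
    Continuous (betaFun ℓ θ F e) :=
  continuous_iff_continuousAt.mpr fun x => (hasDerivAt_betaFun ℓ θ F e x).continuousAt

theorem continuous_betaDeriv (ℓ : E → ℝ) (θ : ℂ) (F : Gmax E) (e : E) :
    Continuous (betaDeriv ℓ θ F e) :=
  continuous_iff_continuousAt.mpr fun x => (hasDerivAt_betaDeriv ℓ θ F e x).continuousAt

theorem contDiff_betaFun (ℓ : E → ℝ) (θ : ℂ) (F : Gmax E) (e : E) :
    ContDiff ℝ 1 (betaFun ℓ θ F e) :=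
  contDiff_one_of_hasDerivAt (hasDerivAt_betaFun ℓ θ F e) (continuous_betaDeriv ℓ θ F e)

theorem contDiff_betaDeriv (ℓ : E → ℝ) (θ : ℂ) (F : Gmax E) (e : E) :
    ContDiff ℝ 1 (betaDeriv ℓ θ F e) :=
  contDiff_one_of_hasDerivAt (hasDerivAt_betaDeriv ℓ θ F e)
    (((continuous_betaFun ℓ θ F e).const_mul _).neg)

theorem utrace_betaFun (ℓ : E → ℝ) (θ : ℂ) (hs : ∀ e, Complex.sin (θ * (ℓ e : ℂ)) ≠ 0)
    (F : Gmax E) : utrace ℓ (betaFun ℓ θ F) = F := by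
  funext ⟨e, b⟩
  cases b <;> simp [utrace, betaFun, hs e]

theorem utrace_congr {ℓ : E → ℝ} (hℓ : ∀ e, 0 ≤ ℓ e) {f g : E → ℝ → ℂ}
    (h : ∀ e, EqOn (f e) (g e) (Icc 0 (ℓ e))) : utrace ℓ f = utrace ℓ g := by
  funext ⟨e, b⟩
  cases b
  · simpa [utrace] using h e (left_mem_Icc.mpr (hℓ e))
  · simpa [utrace] using h e (right_mem_Icc.mpr (hℓ e))

theorem otrace_congr {ℓ : E → ℝ} (hℓ : ∀ e, 0 ≤ ℓ e) {f g : E → ℝ → ℂ}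
    (h : ∀ e, EqOn (f e) (g e) (Icc 0 (ℓ e))) : otrace ℓ f = otrace ℓ g := by
  funext ⟨e, b⟩
  cases b
  · simpa [otrace] using h e (left_mem_Icc.mpr (hℓ e))
  · simpa [otrace] using h e (right_mem_Icc.mpr (hℓ e))

theorem map_otrace_betaDeriv (ℓ : E → ℝ) (P : Gmax E →ₗ[ℂ] Gmax E) (θ c : ℂ) (F : Gmax E) :
    P (otrace ℓ fun e x => betaDeriv ℓ θ F e x / c) = c⁻¹ • QRaw ℓ P θ F := by
  rw [QRaw, ← map_smul]
  congr 1
  funext ⟨e, b⟩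
  cases b <;> simp [otrace, betaDeriv, hopp] <;> ring

/-- A solution of `f' = c g`, `c g' = -θ² f` on `[0, l]` is determined by the boundary values
of `f` whenever `θ²` is not a Dirichlet eigenvalue. -/
theorem mul_sin_eq_of_system {l : ℝ} (hl : 0 < l) {θ c : ℂ} (hθ0 : θ ≠ 0)
    {f g : ℝ → ℂ} (hf : DifferentiableOn ℝ f (Icc 0 l)) (hg : DifferentiableOn ℝ g (Icc 0 l))
    (hf' : ∀ x ∈ Icc 0 l, derivWithin f (Icc 0 l) x = c * g x)
    (hg' : ∀ x ∈ Icc 0 l, c * derivWithin g (Icc 0 l) x = -(θ ^ 2 * f x))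
    {x : ℝ} (hx : x ∈ Icc 0 l) :
    f x * Complex.sin (θ * (l : ℂ)) =
      f 0 * Complex.sin (θ * ((l : ℂ) - (x : ℂ))) + f l * Complex.sin (θ * (x : ℂ)) := by
  have hsin (y : ℝ) := (hasDerivAt_sin_comp (hasDerivAt_mul_ofReal θ y)).hasDerivWithinAt (s := Icc 0 l)
  have hcos (y : ℝ) := (hasDerivAt_cos_comp (hasDerivAt_mul_ofReal θ y)).hasDerivWithinAt (s := Icc 0 l)
  have hA (y : ℝ) (hy : y ∈ Icc 0 l) : HasDerivWithinAt
      (fun y : ℝ => θ * (f y * Complex.cos (θ * y)) - c * (g y * Complex.sin (θ * y))) 0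
      (Icc 0 l) y := by
    have h := (((hf y hy).hasDerivWithinAt.mul (hcos y)).const_mul θ).sub
      (((hg y hy).hasDerivWithinAt.mul (hsin y)).const_mul c)
    refine h.congr_deriv ?_
    linear_combination (θ * Complex.cos (θ * y)) * hf' y hy - Complex.sin (θ * y) * hg' y hy
  have hB (y : ℝ) (hy : y ∈ Icc 0 l) : HasDerivWithinAt
      (fun y : ℝ => θ * (f y * Complex.sin (θ * y)) + c * (g y * Complex.cos (θ * y))) 0
      (Icc 0 l) y := by
    have h := (((hf y hy).hasDerivWithinAt.mul (hsin y)).const_mul θ).add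
      (((hg y hy).hasDerivWithinAt.mul (hcos y)).const_mul c)
    refine h.congr_deriv ?_
    linear_combination (θ * Complex.sin (θ * y)) * hf' y hy + Complex.cos (θ * y) * hg' y hy
  have hconst {u : ℝ → ℂ} (hu : ∀ y ∈ Icc 0 l, HasDerivWithinAt u 0 (Icc 0 l) y) :
      ∀ y ∈ Icc 0 l, u y = u 0 :=
    constant_of_derivWithin_zero (fun y hy => (hu y hy).differentiableWithinAt) fun y hy =>
      (hu y (Ico_subset_Icc_self hy)).derivWithin
        (uniqueDiffOn_Icc hl y (Ico_subset_Icc_self hy))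
  have hl' : l ∈ Icc 0 l := right_mem_Icc.mpr hl.le
  have hAx := hconst hA x hx
  have hBx := hconst hB x hx
  have hAl := hconst hA l hl'
  have hBl := hconst hB l hl'
  simp only [ofReal_zero, mul_zero, Complex.cos_zero, Complex.sin_zero, mul_one,
    sub_zero, zero_add] at hAx hBx hAl hBl
  have hfx : θ * f x = θ * f 0 * Complex.cos (θ * x) + c * g 0 * Complex.sin (θ * x) := by
    linear_combination Complex.cos (θ * x) * hAx + Complex.sin (θ * x) * hBx
      - θ * f x * Complex.sin_sq_add_cos_sq (θ * x)
  have hfl : θ * f l = θ * f 0 * Complex.cos (θ * l) + c * g 0 * Complex.sin (θ * l) := by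
    linear_combination Complex.cos (θ * l) * hAl + Complex.sin (θ * l) * hBl
      - θ * f l * Complex.sin_sq_add_cos_sq (θ * l)
  apply mul_left_cancel₀ hθ0
  rw [mul_sub, Complex.sin_sub]
  linear_combination Complex.sin (θ * l) * hfx - Complex.sin (θ * x) * hfl

/-- For a finite metric graph, `w ≠ ±m`, `z = w² - m² = θ²` off the
Dirichlet spectrum, the map `F ↦ (β(z)F, (β(z)F)'/(w+m))` is a linear bijection from
`ker (Q(z) - (w+m)M)` onto the eigenspace of the Dirac operator `D_{(G,M)}` for the
eigenvalue `w`. -/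
theorem statement2 [Fintype V] [Fintype E] [DecidableEq V]
    (bd : Bool → E → V)
    (ℓ : E → ℝ) (ℓ₀ : ℝ) (hℓ₀ : 0 < ℓ₀) (hℓ : ∀ e, ℓ₀ ≤ ℓ e ∧ ℓ e ≤ 1)
    (G : Submodule ℂ (Gmax E)) (P : Gmax E →ₗ[ℂ] Gmax E)
    (hPmem : ∀ F, P F ∈ G) (hPfix : ∀ F ∈ G, P F = F)
    (hPsa : ∀ F F' : Gmax E, vinner (P F) F' = vinner F (P F'))
    (hPloc : ∀ (F : Gmax E) (v : V), P (restrAt bd v F) = restrAt bd v (P F))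
    (m : ℝ) (M : G →ₗ[ℂ] G)
    (hM : ∀ x y : G,
      vinner (↑(M x) : Gmax E) (↑y : Gmax E) = vinner (↑x : Gmax E) (↑(M y) : Gmax E))
    (w θ : ℂ) (hw : w ≠ (m : ℂ) ∧ w ≠ -(m : ℂ)) (hθ : θ ^ 2 = w ^ 2 - (m : ℂ) ^ 2)
    (hz : ∀ e, ∀ k : ℕ, 1 ≤ k →
      w ^ 2 - (m : ℂ) ^ 2 ≠ ((Real.pi * k / ℓ e : ℝ) : ℂ) ^ 2) :
    -- the map sends `ker (Q(z) - (w+m)M)` into the Dirac eigenspace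
    (∀ F : G, QRaw ℓ P θ (↑F : Gmax E) = (w + (m : ℂ)) • (↑(M F) : Gmax E) →
        IsDiracEigenfun ℓ G P M m w (betaFun ℓ θ (↑F : Gmax E))
          (fun e x => deriv (betaFun ℓ θ (↑F : Gmax E) e) x / (w + (m : ℂ)))) ∧
    -- the map is linear
    (∀ (F F' : Gmax E) (c : ℂ) (e : E) (x : ℝ),
        betaFun ℓ θ (F + c • F') e x = betaFun ℓ θ F e x + c * betaFun ℓ θ F' e x) ∧
    -- it is a bijection onto the eigenspace
    (∀ f₀ f₁ : E → ℝ → ℂ, IsDiracEigenfun ℓ G P M m w f₀ f₁ →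
        ∃! F : G, QRaw ℓ P θ (↑F : Gmax E) = (w + (m : ℂ)) • (↑(M F) : Gmax E) ∧
          (∀ e, EqOn (f₀ e) (betaFun ℓ θ (↑F : Gmax E) e) (Icc 0 (ℓ e))) ∧
          (∀ e, EqOn (f₁ e)
            (fun x => deriv (betaFun ℓ θ (↑F : Gmax E) e) x / (w + (m : ℂ)))
            (Icc 0 (ℓ e)))) := by
  have hℓpos (e : E) : 0 < ℓ e := hℓ₀.trans_le (hℓ e).1
  have hwm : w + (m : ℂ) ≠ 0 := fun h => hw.2 (eq_neg_of_add_eq_zero_left h)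
  have hz0 : w ^ 2 - (m : ℂ) ^ 2 ≠ 0 := by
    rw [sq_sub_sq]
    exact mul_ne_zero hwm (sub_ne_zero.mpr hw.1)
  have hθ0 : θ ≠ 0 := by
    rintro rfl
    exact hz0 (by simpa using hθ.symm)
  have hs (e : E) : Complex.sin (θ * (ℓ e : ℂ)) ≠ 0 :=
    sin_mul_ne_zero_of_off_dirichlet (hℓpos e) hθ hz0 (hz e)
  have huniq (e : E) := uniqueDiffOn_Icc (hℓpos e)
  simp only [deriv_betaFun]
  refine ⟨fun F hF => ⟨fun e => (contDiff_betaFun ℓ θ F e).contDiffOn,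
    fun e => ((contDiff_betaDeriv ℓ θ F e).div_const _).contDiffOn, fun e x hx => ?_,
    fun e x hx => ?_, ?_⟩, fun F F' c e x => ?_, fun f₀ f₁ hf => ?_⟩
  · rw [((hasDerivAt_betaDeriv ℓ θ F e x).div_const _).hasDerivWithinAt.derivWithin
      (huniq e x hx), hθ]
    field_simp
    ring
  · rw [(hasDerivAt_betaFun ℓ θ F e x).hasDerivWithinAt.derivWithin (huniq e x hx)]
    field_simp
    ring
  · have hu := utrace_betaFun ℓ θ hs (F : Gmax E)
    refine ⟨hu.symm ▸ F.2, ?_⟩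
    rw [map_otrace_betaDeriv, hF, inv_smul_smul₀ hwm]
    congr 2
    exact Subtype.ext hu.symm
  · simp only [betaFun, Pi.add_apply, Pi.smul_apply, smul_eq_mul]
    ring
  · obtain ⟨hc₀, hc₁, h₁, h₀, hmem, hP⟩ := hf
    have hf₀' (e : E) (x : ℝ) (hx : x ∈ Icc 0 (ℓ e)) :
        derivWithin (f₀ e) (Icc 0 (ℓ e)) x = (w + m) * f₁ e x := by
      linear_combination h₀ e x hx
    have hEq₀ (e : E) : EqOn (f₀ e) (betaFun ℓ θ (utrace ℓ f₀) e) (Icc 0 (ℓ e)) := by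
      intro x hx
      have h := mul_sin_eq_of_system (hℓpos e) hθ0 ((hc₀ e).differentiableOn one_ne_zero)
        ((hc₁ e).differentiableOn one_ne_zero) (hf₀' e)
        (fun y hy => by linear_combination (-(w + m)) * h₁ e y hy + f₀ e y * hθ) hx
      simp only [betaFun, utrace, if_true, Bool.false_eq_true, if_false]
      rw [← add_div, eq_div_iff (hs e), h]
    have hEq₁ (e : E) : EqOn (f₁ e)
        (fun x => betaDeriv ℓ θ (utrace ℓ f₀) e x / (w + m)) (Icc 0 (ℓ e)) := by
      intro x hx
      have h := derivWithin_congr (hEq₀ e) (hEq₀ e hx)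
      rw [hf₀' e x hx, (hasDerivAt_betaFun ℓ θ _ e x).hasDerivWithinAt.derivWithin
        (huniq e x hx)] at h
      rw [eq_div_iff hwm, ← h, mul_comm]
    refine ⟨⟨utrace ℓ f₀, hmem⟩, ⟨?_, hEq₀, hEq₁⟩, fun F hF => Subtype.ext ?_⟩
    · rw [← hP, otrace_congr (fun e => (hℓpos e).le) hEq₁, map_otrace_betaDeriv,
        smul_inv_smul₀ hwm]
    · exact ((utrace_congr (fun e => (hℓpos e).le) hF.2.1).trans (utrace_betaFun ℓ θ hs F)).symm
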